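/- (Theorem 1, optimality, continuous allocations.) Assume the continuous MPSP setting and let (C*, n*) be an equal-finish point. Then the constant allocation a_m(t) := n*_m for t ∈ [0,C*] is a feasible continuous allocation with makespan C*, and for every feasible continuous allocation with makespan C one has C ≥ C*. Hence C* is the minimum achievable makespan, and in the optimal plan all projects start simultaneously at time 0 and finish together at time C*. -/

import Mathlib

open MeasureTheory

/-- A feasible continuous allocation for the continuous MPSP setting:
`a m` is the (time-varying) device allocation of project `m` on `[0, C]`;
allocations are nonnegative, respect the capacity `N` at every time,
are integrable together with the resulting speeds, and complete
the workload `L m` of every project within the makespan `C`. -/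
def FeasibleAlloc {M : Type*} [Fintype M] (L : M → ℝ) (f : M → ℝ → ℝ) (N : ℝ)
    (a : M → ℝ → ℝ) (C : ℝ) : Prop :=
  0 < C ∧
  (∀ m, ∀ t ∈ Set.Icc (0 : ℝ) C, 0 ≤ a m t) ∧
  (∀ t ∈ Set.Icc (0 : ℝ) C, ∑ m, a m t ≤ N) ∧
  (∀ m, IntegrableOn (a m) (Set.Icc 0 C)) ∧
  (∀ m, IntegrableOn (fun t => f m (a m t)) (Set.Icc 0 C)) ∧
  (∀ m, L m ≤ ∫ t in Set.Icc (0 : ℝ) C, f m (a m t))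

/-- A concave function that is nonnegative on `[0, ∞)` is monotone there. -/
theorem ConcaveOn.monotoneOn_Ici_of_nonneg {g : ℝ → ℝ} (hg : ConcaveOn ℝ (Set.Ici 0) g)
    (hnonneg : ∀ x, 0 ≤ x → 0 ≤ g x) : MonotoneOn g (Set.Ici 0) := by
  intro x hx y hy hxy
  by_contra! hlt
  have hx0 : (0 : ℝ) ≤ x := hx
  have hgy := hnonneg y hy
  have hgx : 0 < g x := hgy.trans_lt hlt
  set θ := (g x - g y) / (2 * g x) with hθ
  have hθ0 : 0 < θ := div_pos (by linarith) (by linarith)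
  have hθ1 : θ ≤ 1 := by rw [hθ, div_le_one (by linarith)]; linarith
  have hθx : θ * g x = (g x - g y) / 2 := by rw [hθ]; field_simp
  have hz : 0 ≤ x + (y - x) / θ := add_nonneg hx0 (div_nonneg (by linarith) hθ0.le)
  have h := hg.2 hx (Set.mem_Ici.2 hz) (sub_nonneg.2 hθ1) hθ0.le (by ring)
  have hcomb : (1 - θ) • x + θ • (x + (y - x) / θ) = y := by
    simp only [smul_eq_mul]
    field_simp
    ring
  rw [hcomb] at h
  simp only [smul_eq_mul] at h
  nlinarith [mul_nonneg hθ0.le (hnonneg _ hz)]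

/-- Jensen's inequality for the average over `[0, C]` of a nonnegative function. -/
theorem ConcaveOn.integral_div_le_map_integral_div {g a : ℝ → ℝ} {C : ℝ} (hC : 0 < C)
    (hg : ConcaveOn ℝ (Set.Ici 0) g) (hcont : ContinuousOn g (Set.Ici 0))
    (ha : ∀ t ∈ Set.Icc (0 : ℝ) C, 0 ≤ a t) (hai : IntegrableOn a (Set.Icc 0 C))
    (hgi : IntegrableOn (fun t => g (a t)) (Set.Icc 0 C)) :
    (∫ t in Set.Icc (0 : ℝ) C, g (a t)) / C ≤ g ((∫ t in Set.Icc (0 : ℝ) C, a t) / C) := by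
  have h := hg.le_map_set_average hcont isClosed_Ici (by simp [hC]) (by simp)
    ((ae_restrict_iff' measurableSet_Icc).2 (.of_forall ha)) hai hgi
  simpa [setAverage_eq, Measure.real, hC.le, div_eq_inv_mul] using h

/-- Theorem 1 (optimality, continuous allocations): for an equal-finish point
`(Cstar, nstar)`, the constant allocation `a m t := nstar m` is a feasible
continuous allocation with makespan `Cstar`, and every feasible continuous
allocation with makespan `C` satisfies `C ≥ Cstar`.  Hence `Cstar` is the
minimum achievable makespan: all projects start at time `0` and finish
together at time `Cstar`. -/
theorem mpsp_optimality {M : Type*} [Fintype M] [Nonempty M]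
    (L : M → ℝ) (hL : ∀ m, 0 < L m)
    (f : M → ℝ → ℝ)
    (hconc : ∀ m, ConcaveOn ℝ (Set.Ici 0) (f m))
    (hcont : ∀ m, ContinuousOn (f m) (Set.Ici 0))
    (hnonneg : ∀ m, ∀ x : ℝ, 0 ≤ x → 0 ≤ f m x)
    (hzero : ∀ m, f m 0 = 0)
    (N : ℝ) (hN : 0 < N)
    (Cstar : ℝ) (nstar : M → ℝ) (hCstar : 0 < Cstar)
    (hnstar_nonneg : ∀ m, 0 ≤ nstar m)
    (hfinish : ∀ m, f m (nstar m) * Cstar = L m)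
    (hsum : ∑ m, nstar m = N) :
    FeasibleAlloc L f N (fun m _ => nstar m) Cstar ∧
    (∀ (a : M → ℝ → ℝ) (C : ℝ), FeasibleAlloc L f N a C → Cstar ≤ C) := by
  refine ⟨⟨hCstar, fun m _ _ => hnstar_nonneg m, fun _ _ => hsum.le,
    fun m => integrableOn_const (by simp), fun m => integrableOn_const (by simp), fun m => ?_⟩, ?_⟩
  · simp [Measure.real, hCstar.le, ← hfinish m, mul_comm]
  · rintro a C ⟨hC, ha, hcap, hai, hfi, hload⟩
    by_contra! hlt
    have hgt : ∀ m, nstar m < (∫ t in Set.Icc (0 : ℝ) C, a m t) / C := by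
      intro m
      have hmean : 0 ≤ (∫ t in Set.Icc (0 : ℝ) C, a m t) / C :=
        div_nonneg (setIntegral_nonneg measurableSet_Icc (ha m)) hC.le
      have hspeed : f m (nstar m) < f m ((∫ t in Set.Icc (0 : ℝ) C, a m t) / C) :=
        calc f m (nstar m) = L m / Cstar := by rw [← hfinish m, mul_div_cancel_right₀ _ hCstar.ne']
          _ < L m / C := div_lt_div_of_pos_left (hL m) hC hlt
          _ ≤ (∫ t in Set.Icc (0 : ℝ) C, f m (a m t)) / C :=
            div_le_div_of_nonneg_right (hload m) hC.le
          _ ≤ _ := (hconc m).integral_div_le_map_integral_div hC (hcont m) (ha m) (hai m) (hfi m)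
      exact ((hconc m).monotoneOn_Ici_of_nonneg (hnonneg m)).reflect_lt
        (hnstar_nonneg m) hmean hspeed
    have hlower : N < ∑ m, (∫ t in Set.Icc (0 : ℝ) C, a m t) / C :=
      hsum ▸ Finset.sum_lt_sum_of_nonempty Finset.univ_nonempty fun m _ => hgt m
    have hupper : ∑ m, ∫ t in Set.Icc (0 : ℝ) C, a m t ≤ N * C := by
      rw [← integral_finsetSum _ fun m _ => hai m]
      refine (setIntegral_mono_on (integrable_finsetSum _ fun m _ => hai m)
        (integrableOn_const (by simp)) measurableSet_Icc hcap).trans_eq ?_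
      simp [Measure.real, hC.le, mul_comm]
    rw [← Finset.sum_div, lt_div_iff₀ hC] at hlower
    exact hlower.not_ge hupper
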